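/- arXiv:2403.09893 — 3 statements merged into one kernel-verified Lean document; each statement's English description precedes it below -/
import Mathlib

section
/- For every string T[1..n], the greedy LZ parse — the leftward parse that, processing T from left to right, chooses each copied part as long as possible — produces the minimum number of phrases among all leftward parses of T. That is, if z is the number of phrases of the greedy LZ parse and z' is the number of phrases of any leftward parse of T, then z ≤ z'. -/
/-- A phrase of a leftward parse: a copied part of length `len`
(whose source starts at 0-based position `src`; `src` is only meaningful when
`len > 0`), followed by one explicit character. -/
structure Phrase where
  len : ℕ
  src : ℕ

/-- Starting position (0-based) of the `k`-th phrase of the parse `P`. -/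
def phraseStart (P : List Phrase) (k : ℕ) : ℕ :=
  ((P.take k).map (fun p => p.len + 1)).sum

/-- `P` is a leftward parse of the length-`n` string `T` (0-based positions):
the phrases cover `T`, and every phrase with a nonempty copied part has a source
occurrence starting strictly before the phrase and matching it. -/
def IsLeftwardParse {α : Type*} (n : ℕ) (T : ℕ → α) (P : List Phrase) : Prop :=
  ((P.map (fun p => p.len + 1)).sum = n) ∧
  ∀ k (hk : k < P.length),
    0 < (P.get ⟨k, hk⟩).len →
      (P.get ⟨k, hk⟩).src < phraseStart P k ∧
      ∀ l < (P.get ⟨k, hk⟩).len,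
        T ((P.get ⟨k, hk⟩).src + l) = T (phraseStart P k + l)

/-- The greedy LZ parse: a leftward parse that, at each step, chooses the
copied part as long as possible. -/
def IsGreedyLZ {α : Type*} (n : ℕ) (T : ℕ → α) (P : List Phrase) : Prop :=
  IsLeftwardParse n T P ∧
  ∀ k (hk : k < P.length), ∀ ℓ',
    phraseStart P k + ℓ' < n →
    (∃ s < phraseStart P k, ∀ l < ℓ', T (s + l) = T (phraseStart P k + l)) →
    ℓ' ≤ (P.get ⟨k, hk⟩).len

theorem phraseStart_succ (P : List Phrase) (k : ℕ) (hk : k < P.length) :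
    phraseStart P (k + 1) = phraseStart P k + ((P.get ⟨k, hk⟩).len + 1) := by
  rw [phraseStart, List.take_add_one, List.getElem?_eq_getElem hk]
  simp only [phraseStart, List.map_append, List.sum_append, Option.toList_some, List.map_cons,
    List.map_nil, List.sum_singleton, List.get_eq_getElem]

theorem phraseStart_le_sum (P : List Phrase) (k : ℕ) :
    phraseStart P k ≤ (P.map (fun p => p.len + 1)).sum := by
  conv_rhs => rw [← List.take_append_drop k P, List.map_append, List.sum_append]
  exact Nat.le_add_right _ _

/-- After equally many phrases, the greedy parse has advanced at least as far as any other
leftward parse. -/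
theorem IsGreedyLZ.phraseStart_le {α : Type*} {n : ℕ} {T : ℕ → α} {P P' : List Phrase}
    (hP : IsGreedyLZ n T P) (hP' : IsLeftwardParse n T P') (k : ℕ)
    (hk : k ≤ P.length) (hk' : k ≤ P'.length) :
    phraseStart P' k ≤ phraseStart P k := by
  induction k with
  | zero => simp [phraseStart]
  | succ k ih =>
    have ih := ih (by omega) (by omega)
    have hle := phraseStart_le_sum P' (k + 1)
    rw [hP'.1] at hle
    rw [phraseStart_succ P' k hk'] at hle ⊢
    rw [phraseStart_succ P k hk]
    by_contra! hlt
    obtain ⟨hsrc, hmatch⟩ := hP'.2 k hk' (by omega)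
    obtain ⟨d, hd⟩ := Nat.exists_eq_add_of_le ih
    have hmax := hP.2 k hk ((P'.get ⟨k, hk'⟩).len - d) (by omega)
      ⟨(P'.get ⟨k, hk'⟩).src + d, by omega, fun l hl => by
        have h := hmatch (d + l) (by omega)
        rwa [← Nat.add_assoc, ← Nat.add_assoc, ← hd] at h⟩
    omega

/-- The greedy LZ parse produces the minimum number of phrases among all
leftward parses of `T`. -/
theorem greedy_lz_minimizes_phrases {α : Type*} (n : ℕ) (T : ℕ → α)
    (P P' : List Phrase) (hP : IsGreedyLZ n T P) (hP' : IsLeftwardParse n T P') :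
    P.length ≤ P'.length := by
  by_contra! hlt
  have hle := hP.phraseStart_le hP' P'.length hlt.le le_rfl
  have hend : phraseStart P' P'.length = n := by
    rw [phraseStart, List.take_length, hP'.1]
  have hnext := phraseStart_le_sum P (P'.length + 1)
  rw [phraseStart_succ P _ hlt, hP.1.1] at hnext
  omega
end

section
/- Suppose a leftward parse of the prefix T[1..i−1] with chain-length array C[1..i−1] satisfying C[j] ≤ c for all j < i is given. Let ℓ ≥ 1 and let s < i satisfy T[s..s+ℓ−1] = T[i..i+ℓ−1]. Then extending the parse by the phrase T[i..i+ℓ] with source s yields chain lengths C[i..i+ℓ] that are all at most c (with C[i+ℓ] = 0) if and only if C[s+m] < c for all 0 ≤ m < min(ℓ, i−s). -/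
/-- `C` satisfies the chain-length recurrences for the parse `P`:
the explicit final position of each phrase has chain length `0`; a copied
position takes the chain length of its source position plus one; and in the
overlapping case the chain lengths repeat with the period of the overlap. -/
def ChainSpec (P : List Phrase) (C : ℕ → ℕ) : Prop :=
  ∀ k (hk : k < P.length),
    C (phraseStart P k + (P.get ⟨k, hk⟩).len) = 0 ∧
    ∀ l < (P.get ⟨k, hk⟩).len,
      if l < phraseStart P k - (P.get ⟨k, hk⟩).src then
        C (phraseStart P k + l) = C ((P.get ⟨k, hk⟩).src + l) + 1
      else
        C (phraseStart P k + l) =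
          C (phraseStart P k + l % (phraseStart P k - (P.get ⟨k, hk⟩).src))

theorem phraseStart_append_length (P : List Phrase) (p : Phrase) :
    phraseStart (P ++ [p]) P.length = (P.map (fun p => p.len + 1)).sum := by
  simp [phraseStart]

theorem ChainSpec.last_phrase {P : List Phrase} {p : Phrase} {C : ℕ → ℕ} {i : ℕ}
    (hC : ChainSpec (P ++ [p]) C) (hi : (P.map (fun p => p.len + 1)).sum = i) :
    C (i + p.len) = 0 ∧ ∀ l < p.len,
      if l < i - p.src then C (i + l) = C (p.src + l) + 1
      else C (i + l) = C (i + l % (i - p.src)) := by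
  have h := hC P.length (by simp)
  rw [phraseStart_append_length, hi] at h
  simpa using h

/-- Extending a parse of `T[0..i-1]` (whose chain lengths are all `≤ c`) by a
phrase of copied length `ℓ ≥ 1` with source `s < i` keeps all chain lengths
`≤ c` (with the new explicit position getting chain length `0`) if and only if
`C[s+m] < c` for all `0 ≤ m < min(ℓ, i-s)`. -/
theorem extend_parse_within_bound_iff {α : Type*} (T : ℕ → α) (i c : ℕ)
    (P : List Phrase) (C : ℕ → ℕ)
    (hP : IsLeftwardParse i T P) (hC : ChainSpec P C)
    (hbound : ∀ j < i, C j ≤ c)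
    (ℓ s : ℕ) (hℓ : 1 ≤ ℓ) (hs : s < i)
    (hocc : ∀ l < ℓ, T (s + l) = T (i + l))
    (C' : ℕ → ℕ) (hC' : ChainSpec (P ++ [Phrase.mk ℓ s]) C')
    (hagree : ∀ j < i, C' j = C j) :
    C' (i + ℓ) = 0 ∧
    ((∀ j, i ≤ j → j ≤ i + ℓ → C' j ≤ c) ↔
      ∀ m < min ℓ (i - s), C (s + m) < c) := by
  obtain ⟨hzero, hcopy⟩ := hC'.last_phrase hP.1
  dsimp only at hzero hcopy
  have hshort : ∀ m < min ℓ (i - s), C' (i + m) = C (s + m) + 1 := by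
    intro m hm
    have h := hcopy m (by omega)
    rwa [if_pos (by omega), hagree (s + m) (by omega)] at h
  refine ⟨hzero, fun h m hm => ?_, fun h j hij hj => ?_⟩
  · have h1 := h (i + m) (by omega) (by omega)
    rw [hshort m hm] at h1
    omega
  · obtain ⟨l, rfl⟩ := Nat.exists_eq_add_of_le hij
    rcases Nat.lt_or_ge l ℓ with hl | hl
    · by_cases hlt : l < i - s
      · rw [hshort l (by omega)]
        exact h l (by omega)
      · have hrep := hcopy l hl
        rw [if_neg hlt] at hrep
        have hmod : l % (i - s) < i - s := Nat.mod_lt _ (by omega)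
        rw [hrep, hshort _ (by omega)]
        exact h _ (by omega)
    · obtain rfl : l = ℓ := by omega
      omega
end

section
/- Greedy phrase-length maximization does not determine the size of a BAT-LZ parse, and need not yield a minimum-size one: there exist a string T, a bound c, and two BAT-LZ parses of T with parameter c which both, at every step (processing left to right), choose as the copied part of the next phrase a longest valid prefix of the remaining suffix, yet have different total numbers of phrases. (A witness is T = alabaralalabarda$ with c = 2, where different choices of sources for the same greedy phrase lengths lead to parses with 8 and 7 phrases, respectively.) -/
/-- The prefix of length `ℓ` of `T[i..]` is valid (w.r.t. chain lengths `C`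
of the already parsed prefix `T[0..i-1]` and the bound `c`): it is empty, or it
has a source occurrence starting before `i` all of whose non-overlapping
positions have chain length strictly below `c`. -/
def ValidPrefix {α : Type*} (T : ℕ → α) (C : ℕ → ℕ) (i c ℓ : ℕ) : Prop :=
  ℓ = 0 ∨ ∃ s < i, (∀ l < ℓ, T (s + l) = T (i + l)) ∧
    ∀ m < min ℓ (i - s), C (s + m) < c

instance {α : Type*} [DecidableEq α] (n : ℕ) (T : ℕ → α) (P : List Phrase) :
    Decidable (IsLeftwardParse n T P) := by
  unfold IsLeftwardParse; infer_instance

instance (P : List Phrase) (C : ℕ → ℕ) : Decidable (ChainSpec P C) := by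
  unfold ChainSpec; infer_instance

instance {α : Type*} [DecidableEq α] (T : ℕ → α) (C : ℕ → ℕ) (i c ℓ : ℕ) :
    Decidable (ValidPrefix T C i c ℓ) := by
  unfold ValidPrefix; infer_instance

/-- Greediness of a parse only has to be tested on prefixes shorter than the string. -/
theorem greedy_of_forall_lt {α : Type*} {n c : ℕ} {T : ℕ → α} {P : List Phrase} {C : ℕ → ℕ}
    (h : ∀ k (hk : k < P.length), ∀ ℓ < n, phraseStart P k + ℓ < n →
      ValidPrefix T C (phraseStart P k) c ℓ → ℓ ≤ (P.get ⟨k, hk⟩).len) :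
    ∀ k (hk : k < P.length), ∀ ℓ, phraseStart P k + ℓ < n →
      ValidPrefix T C (phraseStart P k) c ℓ → ℓ ≤ (P.get ⟨k, hk⟩).len :=
  fun k hk ℓ hℓ => h k hk ℓ (by omega) hℓ

/-- The string `alabaralalabarda` followed by a dollar sign, given by its character codes. -/
def alabarWord (i : ℕ) : Char :=
  Char.ofNat ([97, 108, 97, 98, 97, 114, 97, 108, 97, 108, 97, 98, 97, 114, 100, 97, 36].getD i 0)

/-- A greedy parse of `alabarWord` with seven phrases. -/
def shortParse : List Phrase :=
  [⟨0, 0⟩, ⟨0, 0⟩, ⟨1, 0⟩, ⟨1, 0⟩, ⟨3, 0⟩, ⟨4, 2⟩, ⟨1, 0⟩]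

/-- The chain lengths of `shortParse`. -/
def shortChain (i : ℕ) : ℕ :=
  [0, 0, 1, 0, 1, 0, 1, 1, 2, 0, 2, 1, 2, 1, 0, 1, 0].getD i 0

/-- A greedy parse of `alabarWord` with eight phrases. -/
def longParse : List Phrase :=
  [⟨0, 0⟩, ⟨0, 0⟩, ⟨1, 0⟩, ⟨1, 2⟩, ⟨3, 0⟩, ⟨2, 2⟩, ⟨1, 5⟩, ⟨1, 0⟩]

/-- The chain lengths of `longParse`. -/
def longChain (i : ℕ) : ℕ :=
  [0, 0, 1, 0, 2, 0, 1, 1, 2, 0, 2, 1, 0, 1, 0, 1, 0].getD i 0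

/-- Greedy phrase-length maximization does not determine the size of a BAT-LZ
parse: there are a string `T`, a bound `c`, and two BAT-LZ parses of `T` with
parameter `c` which both, at every step, choose a longest valid prefix as the
copied part of the next phrase, yet have different numbers of phrases. -/
theorem greedy_batlz_not_unique_size :
    ∃ (n : ℕ) (T : ℕ → Char) (c : ℕ) (P P' : List Phrase) (C C' : ℕ → ℕ),
      IsLeftwardParse n T P ∧ ChainSpec P C ∧ (∀ j < n, C j ≤ c) ∧
      IsLeftwardParse n T P' ∧ ChainSpec P' C' ∧ (∀ j < n, C' j ≤ c) ∧
      (∀ k (hk : k < P.length), ∀ ℓ', phraseStart P k + ℓ' < n →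
        ValidPrefix T C (phraseStart P k) c ℓ' → ℓ' ≤ (P.get ⟨k, hk⟩).len) ∧
      (∀ k (hk : k < P'.length), ∀ ℓ', phraseStart P' k + ℓ' < n →
        ValidPrefix T C' (phraseStart P' k) c ℓ' → ℓ' ≤ (P'.get ⟨k, hk⟩).len) ∧
      P.length ≠ P'.length := by
  refine ⟨17, alabarWord, 2, shortParse, longParse, shortChain, longChain,
    ?_, ?_, ?_, ?_, ?_, ?_, greedy_of_forall_lt ?_, greedy_of_forall_lt ?_, ?_⟩ <;>
    decide +kernel
end
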